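/- Let f : ℝ × [0,∞) → ℝ be continuous in t and globally Lipschitz continuous in z, uniformly in t. Let z₁, z₂, z₃ : [0,∞) → ℝ be solutions of the scalar ODE dz(t)/dt = f(z(t), t) with z₂(0) < z₁(0) < z₃(0), and let ε satisfy 0 < ε ≤ min{|z₂(0) − z₁(0)|, |z₃(0) − z₁(0)|}. If z̃₁ is any solution of the same ODE whose initial state satisfies |z̃₁(0) − z₁(0)| < ε, then for every T ≥ 0 the deviation of the output is bounded as |z̃₁(T) − z₁(T)| ≤ |z₃(T) − z₂(T)|. -/

import Mathlib

open Set

/-- Solutions of a scalar ODE with right-hand side uniformly Lipschitz in the state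
preserve strict order. -/
theorem ODE_solution_lt_of_lt {f : ℝ → ℝ → ℝ} {L : ℝ} (hL : 0 ≤ L)
    (hlip : ∀ (x y : ℝ) (t : ℝ), 0 ≤ t → |f x t - f y t| ≤ L * |x - y|) {u v : ℝ → ℝ}
    (hu : ∀ t ∈ Ici (0 : ℝ), HasDerivWithinAt u (f (u t) t) (Ici (0 : ℝ)) t)
    (hv : ∀ t ∈ Ici (0 : ℝ), HasDerivWithinAt v (f (v t) t) (Ici (0 : ℝ)) t)
    (h0 : u 0 < v 0) {T : ℝ} (hT : 0 ≤ T) : u T < v T := by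
  by_contra! hle
  have cont {w : ℝ → ℝ} (b : ℝ)
      (hw : ∀ t ∈ Ici (0 : ℝ), HasDerivWithinAt w (f (w t) t) (Ici (0 : ℝ)) t) :
      ContinuousOn w (Icc 0 b) := fun t ht =>
    (hw t ht.1).continuousWithinAt.mono Icc_subset_Ici_self
  obtain ⟨c, hc, hzero⟩ : (0 : ℝ) ∈ (fun t => u t - v t) '' Icc 0 T :=
    intermediate_value_Icc hT ((cont T hu).sub (cont T hv))
      ⟨by simpa using h0.le, by simpa using hle⟩
  have deriv {w : ℝ → ℝ}
      (hw : ∀ t ∈ Ici (0 : ℝ), HasDerivWithinAt w (f (w t) t) (Ici (0 : ℝ)) t) :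
      ∀ t ∈ Ioc 0 c, HasDerivWithinAt w (f (w t) t) (Iic t) t := fun t ht =>
    ((hw t ht.1.le).hasDerivAt (Ici_mem_nhds ht.1)).hasDerivWithinAt
  have heq : EqOn u v (Icc 0 c) :=
    ODE_solution_unique_of_mem_Icc_left (v := fun t x => f x t) (s := fun _ => univ)
      (K := L.toNNReal)
      (fun t ht => LipschitzOnWith.of_dist_le_mul fun x _ y _ => by
        simpa [Real.dist_eq, Real.coe_toNNReal L hL] using hlip x y t ht.1.le)
      (cont c hu) (deriv hu) (fun _ _ => mem_univ _)
      (cont c hv) (deriv hv) (fun _ _ => mem_univ _) (sub_eq_zero.mp hzero)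
  exact h0.ne (heq ⟨le_rfl, hc.1⟩)

/-- A solution starting within ε of z₁(0), where ε is at most the distance to the
sandwiching curves z₂ and z₃, has its deviation at any time T bounded by |z₃(T) − z₂(T)|. -/
theorem stmt_2
    (f : ℝ → ℝ → ℝ)
    (hcont : ∀ x, ContinuousOn (fun t => f x t) (Ici (0 : ℝ)))
    (L : ℝ) (hL : 0 ≤ L)
    (hlip : ∀ (x y : ℝ) (t : ℝ), 0 ≤ t → |f x t - f y t| ≤ L * |x - y|)
    (z₁ z₂ z₃ w₁ : ℝ → ℝ)
    (hz₁ : ∀ t ∈ Ici (0 : ℝ), HasDerivWithinAt z₁ (f (z₁ t) t) (Ici (0 : ℝ)) t)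
    (hz₂ : ∀ t ∈ Ici (0 : ℝ), HasDerivWithinAt z₂ (f (z₂ t) t) (Ici (0 : ℝ)) t)
    (hz₃ : ∀ t ∈ Ici (0 : ℝ), HasDerivWithinAt z₃ (f (z₃ t) t) (Ici (0 : ℝ)) t)
    (hw₁ : ∀ t ∈ Ici (0 : ℝ), HasDerivWithinAt w₁ (f (w₁ t) t) (Ici (0 : ℝ)) t)
    (h0 : z₂ 0 < z₁ 0 ∧ z₁ 0 < z₃ 0)
    (ε : ℝ) (hε : 0 < ε)
    (hεle : ε ≤ min |z₂ 0 - z₁ 0| |z₃ 0 - z₁ 0|)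
    (hinit : |w₁ 0 - z₁ 0| < ε) :
    ∀ T ≥ (0 : ℝ), |w₁ T - z₁ T| ≤ |z₃ T - z₂ T| := by
  intro T hT
  obtain ⟨h₂₁, h₁₃⟩ := h0
  obtain ⟨hε₂, hε₃⟩ := le_min_iff.mp hεle
  rw [abs_of_neg (sub_neg.mpr h₂₁)] at hε₂
  rw [abs_of_pos (sub_pos.mpr h₁₃)] at hε₃
  obtain ⟨hlow, hhigh⟩ := abs_lt.mp hinit
  have hz₂₁ := ODE_solution_lt_of_lt hL hlip hz₂ hz₁ h₂₁ hT
  have hz₁₃ := ODE_solution_lt_of_lt hL hlip hz₁ hz₃ h₁₃ hT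
  have hw₂ := ODE_solution_lt_of_lt hL hlip hz₂ hw₁ (by linarith) hT
  have hw₃ := ODE_solution_lt_of_lt hL hlip hw₁ hz₃ (by linarith) hT
  rw [abs_of_pos (by linarith : 0 < z₃ T - z₂ T), abs_le]
  constructor <;> linarith
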